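/- Let 𝓖₁ be the set of all strongly everywhere surjective functions f : ℂ → ℂ that have the Baire property (the preimage under f of every open set has the Baire property) but are neither Lebesgue measurable nor s(ℂ)-measurable (i.e. there is an open set whose preimage under f is not Lebesgue measurable, and an open set whose preimage does not belong to the Marczewski σ-algebra s(ℂ)). Then 𝓖₁ is strongly 2^𝔠-algebrable in the algebra ℂ^ℂ, where 𝔠 is the cardinality of the continuum. -/

import Mathlib

open Cardinal

/-- A subset `E` of a commutative `K`-algebra `A` is strongly `lam`-algebrable: `E ∪ {0}`
contains a free commutative `K`-algebra with `lam` free generators; concretely, there is an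
injective family of `lam` elements of `E` such that every nonzero polynomial over `K` without
constant term, evaluated at distinct members of the family, is nonzero and belongs to `E`. -/
def StronglyAlgebrable (K : Type) {A : Type} [CommRing K] [CommRing A] [Algebra K A]
    (E : Set A) (lam : Cardinal) : Prop :=
  ∃ (ι : Type) (x : ι → A), #ι = lam ∧ Function.Injective x ∧
    (∀ i, x i ∈ E) ∧
    ∀ n : ℕ, 0 < n → ∀ P : MvPolynomial (Fin n) K, P ≠ 0 →
      MvPolynomial.constantCoeff P = 0 →
      ∀ ξ : Fin n → ι, Function.Injective ξ →
        MvPolynomial.aeval (fun i => x (ξ i)) P ≠ 0 ∧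
        MvPolynomial.aeval (fun i => x (ξ i)) P ∈ E

/-- A set has the Baire property if it differs from some open set by a meager set. -/
def HasBaireProperty {α : Type} [TopologicalSpace α] (s : Set α) : Prop :=
  ∃ u : Set α, IsOpen u ∧ IsMeagre (symmDiff s u)

/-- The family of subsets of `ℂ` which have the Baire property and are non-meager. -/
def BaireFamily : Set (Set ℂ) :=
  {A | HasBaireProperty A ∧ ¬ IsMeagre A}

/-- `f` is strongly everywhere surjective: on every nonempty open subset of `ℂ`, `f` takes
every complex value `𝔠` many times. -/
def SES : Set (ℂ → ℂ) :=
  {f | ∀ U : Set ℂ, IsOpen U → U.Nonempty → ∀ z : ℂ,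
    #{x : ℂ | x ∈ U ∧ f x = z} = Cardinal.continuum}

/-- The Marczewski σ-algebra `s(ℂ)`: `A ∈ s(ℂ)` iff every nonempty perfect set `P ⊆ ℂ`
contains a nonempty perfect set `Q` with `Q ⊆ A ∩ P` or `Q ⊆ P \ A`. -/
def Marczewski : Set (Set ℂ) :=
  {A | ∀ P : Set ℂ, Perfect P → P.Nonempty →
    ∃ Q : Set ℂ, Perfect Q ∧ Q.Nonempty ∧ (Q ⊆ A ∩ P ∨ Q ⊆ P \ A)}

open MeasureTheory

/-- If there are at most `κ` sets, each with at least `κ` elements (`κ` being the cardinality of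
the index type), they admit an injective choice function. -/
theorem exists_injective_choice {ι α : Type} (S : ι → Set α) (hS : ∀ i, #ι ≤ #(S i)) :
    ∃ c : ι → α, Function.Injective c ∧ ∀ i, c i ∈ S i := by
  obtain ⟨_, _, hord⟩ := exists_ord_eq_type_lt ι
  have key : ∀ (i : ι) (f : ∀ j, j < i → α), ∃ a ∈ S i, ∀ j (h : j < i), f j h ≠ a := by
    intro i f
    by_contra! H
    have hsub : S i ⊆ Set.range fun j : Set.Iio i => f j.1 j.2 := by
      intro a ha
      obtain ⟨j, hj, rfl⟩ := H a ha
      exact ⟨⟨j, hj⟩, rfl⟩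
    exact ((hS i).trans ((mk_le_mk_of_subset hsub).trans mk_range_le)).not_gt (mk_Iio_lt i hord)
  choose g hgS hg using key
  let c : ι → α := (wellFounded_lt (α := ι)).fix g
  have hc : ∀ i, c i = g i fun j _ => c j := fun i => WellFounded.fix_eq _ g i
  have hlt : ∀ i j, j < i → c j ≠ c i := fun i j h => by
    rw [hc i]
    exact hg i (fun j _ => c j) j h
  refine ⟨c, fun i j hij => ?_, fun i => hc i ▸ hgS i _⟩
  rcases lt_trichotomy i j with h | h | h
  · exact (hlt j i h hij).elim
  · exact h
  · exact (hlt i j h hij.symm).elim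

theorem mk_isClosed_le_continuum (α : Type) [TopologicalSpace α] [SecondCountableTopology α] :
    #{C : Set α // IsClosed C} ≤ 𝔠 := by
  have h : #{C : Set α | MeasurableSet[borel α] C} ≤ 𝔠 := by
    rw [(TopologicalSpace.isBasis_countableBasis α).borel_eq_generateFrom]
    exact MeasurableSpace.cardinal_measurableSet_le_continuum
      ((TopologicalSpace.countable_countableBasis α).le_aleph0.trans aleph0_le_continuum)
  refine (mk_le_mk_of_subset fun C (hC : IsClosed C) => ?_).trans h
  borelize α
  exact hC.measurableSet

theorem continuum_le_mk_of_isClosed_of_not_countable {α : Type} [TopologicalSpace α]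
    [PolishSpace α] {C : Set α} (hC : IsClosed C) (hunc : ¬ C.Countable) : 𝔠 ≤ #C := by
  obtain ⟨f, hfC, -, hf⟩ := hC.exists_nat_bool_injection_of_not_countable hunc
  have := mk_le_of_injective (f := fun x => (⟨f x, hfC ⟨x, rfl⟩⟩ : C))
    fun x y h => hf (congrArg Subtype.val h)
  simpa using this

theorem not_countable_of_perfect {α : Type} [MetricSpace α] [CompleteSpace α] {Q : Set α}
    (hQ : Perfect Q) (hne : Q.Nonempty) : ¬ Q.Countable := by
  obtain ⟨f, hfQ, -, hf⟩ := hQ.exists_nat_bool_injection hne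
  intro h
  have h' : (Set.univ : Set (ℕ → Bool)).Countable :=
    Set.MapsTo.countable_of_injOn (fun x _ => hfQ ⟨x, rfl⟩) hf.injOn h
  have hle := h'.le_aleph0
  rw [mk_univ, ← power_def, mk_bool, mk_nat, two_power_aleph0] at hle
  exact hle.not_gt aleph0_lt_continuum

/-- A simultaneous Bernstein decomposition: there is a map onto any given type of cardinality at
most `𝔠` each of whose fibres meets each uncountable closed set in at least `𝔠` points. -/
theorem exists_bernstein_map {α T : Type} [TopologicalSpace α] [PolishSpace α] [Nonempty T]
    (hT : #T ≤ 𝔠) :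
    ∃ b : α → T, ∀ C : Set α, IsClosed C → ¬ C.Countable →
      ∀ t, 𝔠 ≤ #(C ∩ b ⁻¹' {t} : Set α) := by
  classical
  let J := {C : {C : Set α // IsClosed C} // ¬ C.1.Countable} × T × ℂ
  have hJ : #J ≤ 𝔠 := by
    simp only [J, mk_prod, lift_id, mk_complex]
    calc _ ≤ 𝔠 * (𝔠 * 𝔠) := by
          gcongr
          exact (mk_subtype_le _).trans (mk_isClosed_le_continuum α)
      _ = 𝔠 := by simp
  obtain ⟨c, hc, hcS⟩ := exists_injective_choice (fun j : J => j.1.1.1) fun j =>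
    hJ.trans (continuum_le_mk_of_isClosed_of_not_countable j.1.1.2 j.1.2)
  refine ⟨Function.extend c (fun j => j.2.1) fun _ => Classical.arbitrary T,
    fun C hC hunc t => ?_⟩
  have hmem : ∀ s : ℂ, c (⟨⟨C, hC⟩, hunc⟩, t, s) ∈
      C ∩ (Function.extend c (fun j => j.2.1) fun _ => Classical.arbitrary T) ⁻¹' {t} :=
    fun s => ⟨hcS (⟨⟨C, hC⟩, hunc⟩, t, s), by simp [hc.extend_apply]⟩
  have := mk_le_of_injective (f := fun s => (⟨_, hmem s⟩ : ↥(C ∩ _))) fun s s' h => by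
    exact (Prod.ext_iff.1 (Prod.ext_iff.1 (hc (congrArg Subtype.val h))).2).2
  rwa [mk_complex] at this

/-- Index set of the independent family of functions `independentFamily`. -/
abbrev IndependentIndex : Type := Σ F : Finset ℂ, (Set F → ℂ)

theorem mk_independentIndex_le : #IndependentIndex ≤ 𝔠 := by
  rw [mk_sigma]
  calc _ ≤ Cardinal.sum fun _ : Finset ℂ => 𝔠 := by
        refine sum_le_sum _ _ fun F => ?_
        rw [← power_def, mk_complex]
        refine (power_le_power_left continuum_ne_zero (mk_le_aleph0 (α := Set F))).trans ?_
        rw [continuum_power_aleph0]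
    _ = 𝔠 := by simp

/-- The Fichtenholz–Kantorovich–Hausdorff family of functions indexed by the subsets of `ℂ`. -/
def independentFamily (X : Set ℂ) (t : IndependentIndex) : ℂ :=
  t.2 {a | (a : ℂ) ∈ X}

theorem exists_independentFamily_eq {n : ℕ} {ξ : Fin n → Set ℂ} (hξ : Function.Injective ξ)
    (w : Fin n → ℂ) : ∃ t, ∀ i, independentFamily (ξ i) t = w i := by
  classical
  have hsep : ∀ i j, ∃ a, i ≠ j → ¬ (a ∈ ξ i ↔ a ∈ ξ j) := by
    intro i j
    by_contra! H
    exact (H 0).1 (hξ (Set.ext fun a => (H a).2))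
  choose d hd using hsep
  let F : Finset ℂ := Finset.univ.image fun p : Fin n × Fin n => d p.1 p.2
  have htrace : Function.Injective fun i => {a : F | (a : ℂ) ∈ ξ i} := by
    intro i j hij
    by_contra hne
    have hmem : d i j ∈ F := Finset.mem_image.2 ⟨(i, j), Finset.mem_univ _, rfl⟩
    exact hd i j hne (Set.ext_iff.1 hij ⟨d i j, hmem⟩)
  exact ⟨⟨F, Function.extend (fun i => {a : F | (a : ℂ) ∈ ξ i}) w 0⟩,
    fun i => htrace.extend_apply w 0 i⟩

theorem MvPolynomial.eval_surjective_of_constantCoeff_eq_zero {σ K : Type} [Field K]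
    [IsAlgClosed K] {P : MvPolynomial σ K} (hP : P ≠ 0) (h0 : constantCoeff P = 0) (z : K) :
    ∃ w : σ → K, eval w P = z := by
  have : Infinite K := IsAlgClosed.instInfinite
  obtain ⟨a, ha⟩ : ∃ a, eval a P ≠ 0 := by
    by_contra! H
    exact hP (MvPolynomial.funext fun x => by simp [H x])
  let p : Polynomial K := aeval (fun i => Polynomial.C (a i) * Polynomial.X) P
  have hp : ∀ t, p.eval t = eval (fun i => a i * t) P := by
    intro t
    rw [← Polynomial.coe_aeval_eq_eval, MvPolynomial.comp_aeval_apply,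
      ← MvPolynomial.coe_aeval_eq_eval]
    simp
  have hdeg : (p - Polynomial.C z).degree ≠ 0 := by
    intro hdeg
    obtain ⟨k, hk⟩ : ∃ k, p = Polynomial.C k := by
      refine ⟨(p - Polynomial.C z).coeff 0 + z, ?_⟩
      have := Polynomial.eq_C_of_degree_eq_zero hdeg
      rw [Polynomial.C_add, ← this]
      ring
    have e0 := hp 0
    have e1 := hp 1
    simp only [hk, Polynomial.eval_C, mul_one, mul_zero] at e0 e1
    apply ha
    rw [← e1, e0]
    rw [MvPolynomial.eval_zero', h0]
  obtain ⟨t, ht⟩ := IsAlgClosed.exists_root _ hdeg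
  exact ⟨fun i => a i * t, by rw [← hp]; simpa [sub_eq_zero] using ht⟩

theorem exists_isClosed_not_countable_subset {A : Set ℂ} (hA : NullMeasurableSet A)
    (h0 : volume A ≠ 0) : ∃ C ⊆ A, IsClosed C ∧ ¬ C.Countable := by
  obtain ⟨B, hBA, hB, hBae⟩ := hA.exists_measurable_subset_ae_eq
  rw [← measure_congr hBae] at h0
  obtain ⟨C, hCB, hC, hpos⟩ := hB.exists_lt_isCompact (pos_iff_ne_zero.2 h0)
  exact ⟨C, hCB.trans hBA, hC.isClosed, fun h => hpos.ne' (h.measure_zero _)⟩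

/-- A meagre subset of the plane, of full Lebesgue measure. -/
def nonLiouvilleRe : Set ℂ := {z | ¬ Liouville z.re}

theorem measurableSet_nonLiouvilleRe : MeasurableSet nonLiouvilleRe :=
  (IsGδ.setOfPred_liouville.measurableSet.preimage Complex.measurable_re).compl

theorem isMeagre_nonLiouvilleRe : IsMeagre nonLiouvilleRe := by
  have h : IsMeagre {x : ℝ | ¬ Liouville x} := by
    rw [IsMeagre]
    filter_upwards [eventually_residual_liouville] with x hx
    simpa using hx
  exact h.preimage_of_isOpenMap Complex.continuous_re Complex.isOpenMap_re

theorem ae_mem_nonLiouvilleRe : ∀ᵐ z : ℂ, z ∈ nonLiouvilleRe :=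
  (Measure.quasiMeasurePreserving_fst.comp
    Complex.volume_preserving_equiv_real_prod.quasiMeasurePreserving).ae ae_not_liouville

theorem volume_inter_nonLiouvilleRe (A : Set ℂ) :
    volume (A ∩ nonLiouvilleRe) = volume A :=
  measure_inter_conull (mem_ae_iff.1 ae_mem_nonLiouvilleRe)

/-- A function vanishing off a meagre set `M` of full measure, whose fibres within `M` have
at least `𝔠` points in each uncountable closed subset of `M`, belongs to the class `𝓖₁`. -/
theorem ses_baire_nonmeasurable_of_fibers {M : Set ℂ} (hMmeas : MeasurableSet M) (hMmeagre : IsMeagre M)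
    (hMfull : ∀ A : Set ℂ, volume (A ∩ M) = volume A) {f : ℂ → ℂ} (hf0 : ∀ x ∉ M, f x = 0)
    (hf : ∀ C ⊆ M, IsClosed C → ¬ C.Countable → ∀ z, 𝔠 ≤ #(C ∩ f ⁻¹' {z} : Set ℂ)) :
    f ∈ SES ∧
      (∀ V : Set ℂ, IsOpen V → HasBaireProperty (f ⁻¹' V)) ∧
      (∃ V : Set ℂ, IsOpen V ∧ ¬ NullMeasurableSet (f ⁻¹' V)) ∧
      (∃ V : Set ℂ, IsOpen V ∧ f ⁻¹' V ∉ Marczewski) := by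
  have hmeet : ∀ C ⊆ M, IsClosed C → ¬ C.Countable → ∀ z, ∃ x ∈ C, f x = z := by
    intro C hCM hC hunc z
    have : #(C ∩ f ⁻¹' {z} : Set ℂ) ≠ 0 :=
      (continuum_pos.trans_le (hf C hCM hC hunc z)).ne'
    obtain ⟨⟨x, hx, hxz⟩⟩ := mk_ne_zero_iff.1 this
    exact ⟨x, hx, hxz⟩
  have hsub : f ⁻¹' {0}ᶜ ⊆ M := fun x hx => by_contra fun h => hx (hf0 x h)
  have hMpos : volume M ≠ 0 := by
    rw [← Set.univ_inter M, hMfull]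
    simp
  refine ⟨fun U hU hne z => ?_, fun V _ => ?_, ⟨{0}ᶜ, isOpen_compl_singleton, fun hN => ?_⟩,
    ⟨{0}ᶜ, isOpen_compl_singleton, fun hMar => ?_⟩⟩
  · refine le_antisymm ((mk_set_le _).trans mk_complex.le) ?_
    have hpos : volume (U ∩ M) ≠ 0 := by
      rw [hMfull]
      exact hU.measure_ne_zero _ hne
    obtain ⟨C, hCU, hC, hunc⟩ := exists_isClosed_not_countable_subset
      (hU.measurableSet.inter hMmeas).nullMeasurableSet hpos
    exact (hf C (hCU.trans Set.inter_subset_right) hC hunc z).trans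
      (mk_le_mk_of_subset fun x hx => ⟨(hCU hx.1).1, hx.2⟩)
  · by_cases h0 : (0 : ℂ) ∈ V
    · refine ⟨Set.univ, isOpen_univ, hMmeagre.mono fun x hx => by_contra fun h => ?_⟩
      simp [Set.mem_symmDiff, hf0 x h, h0] at hx
    · refine ⟨∅, isOpen_empty, hMmeagre.mono fun x hx => by_contra fun h => ?_⟩
      simp [Set.mem_symmDiff, hf0 x h, h0] at hx
  · have h1 : volume (f ⁻¹' {0}ᶜ) = 0 := by
      by_contra h
      obtain ⟨C, hCA, hC, hunc⟩ := exists_isClosed_not_countable_subset hN h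
      obtain ⟨x, hxC, hx⟩ := hmeet C (hCA.trans hsub) hC hunc 0
      exact hCA hxC hx
    have h2 : volume (M \ f ⁻¹' {0}ᶜ) = 0 := by
      by_contra h
      obtain ⟨C, hCA, hC, hunc⟩ := exists_isClosed_not_countable_subset
        (hMmeas.nullMeasurableSet.diff hN) h
      obtain ⟨x, hxC, hx⟩ := hmeet C (hCA.trans Set.sdiff_subset) hC hunc 1
      exact (hCA hxC).2 (by simp [hx])
    exact hMpos (measure_mono_null (Set.subset_sdiff_union _ _) (measure_union_null h2 h1))
  · obtain ⟨C, hCM, hC, hunc⟩ :=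
      exists_isClosed_not_countable_subset hMmeas.nullMeasurableSet hMpos
    obtain ⟨P, hP, hPne, hPC⟩ := exists_perfect_nonempty_of_isClosed_of_not_countable hC hunc
    obtain ⟨Q, hQ, hQne, hQA | hQA⟩ := hMar P hP hPne
    · obtain ⟨x, hxQ, hx⟩ := hmeet Q (fun x hx => hsub (hQA hx).1) hQ.closed
        (not_countable_of_perfect hQ hQne) 0
      exact (hQA hxQ).1 hx
    · obtain ⟨x, hxQ, hx⟩ := hmeet Q (fun x hx => hCM (hPC (hQA hx).1)) hQ.closed
        (not_countable_of_perfect hQ hQne) 1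
      exact (hQA hxQ).2 (by simp [hx])

/-- The set `𝓖₁` of all strongly everywhere surjective `f : ℂ → ℂ` which have
the Baire property but are neither Lebesgue measurable nor `s(ℂ)`-measurable is strongly
`2 ^ 𝔠`-algebrable in `ℂ^ℂ`. -/
theorem stmt14 :
    StronglyAlgebrable ℂ
      {f : ℂ → ℂ | f ∈ SES ∧
        (∀ V : Set ℂ, IsOpen V → HasBaireProperty (f ⁻¹' V)) ∧
        (∃ V : Set ℂ, IsOpen V ∧ ¬ MeasureTheory.NullMeasurableSet (f ⁻¹' V)) ∧
        (∃ V : Set ℂ, IsOpen V ∧ f ⁻¹' V ∉ Marczewski)}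
      ((2 : Cardinal) ^ Cardinal.continuum) := by
  obtain ⟨b, hb⟩ := exists_bernstein_map (α := ℂ) mk_independentIndex_le
  classical
  let x : Set ℂ → ℂ → ℂ := fun X p => if p ∈ nonLiouvilleRe then independentFamily X (b p) else 0
  have hx : ∀ (n : ℕ) (P : MvPolynomial (Fin n) ℂ) (ξ : Fin n → Set ℂ) (p : ℂ),
      MvPolynomial.aeval (fun i => x (ξ i)) P p = MvPolynomial.eval (fun i => x (ξ i) p) P := by
    intro n P ξ p
    rw [← MvPolynomial.coe_aeval_eq_eval]
    exact MvPolynomial.comp_aeval_apply (fun i => x (ξ i)) (Pi.evalAlgHom ℂ (fun _ : ℂ => ℂ) p) P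
  have hE : ∀ (n : ℕ) (P : MvPolynomial (Fin n) ℂ), P ≠ 0 → MvPolynomial.constantCoeff P = 0 →
      ∀ ξ : Fin n → Set ℂ, Function.Injective ξ → _ := fun n P hP h0 ξ hξ =>
    ses_baire_nonmeasurable_of_fibers measurableSet_nonLiouvilleRe isMeagre_nonLiouvilleRe
      volume_inter_nonLiouvilleRe (f := MvPolynomial.aeval (fun i => x (ξ i)) P)
      (fun p hp => by
        simp only [hx, x, if_neg hp]
        rw [MvPolynomial.eval_zero', h0])
      fun C hCM hC hunc z => by
        obtain ⟨w, hw⟩ := MvPolynomial.eval_surjective_of_constantCoeff_eq_zero hP h0 z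
        obtain ⟨t, ht⟩ := exists_independentFamily_eq hξ w
        refine (hb C hC hunc t).trans (mk_le_mk_of_subset fun p hp => ⟨hp.1, ?_⟩)
        have hpt : b p = t := hp.2
        simp [hx, x, hCM hp.1, hpt, ht, hw]
  have hne : ∀ f ∈ SES, f ≠ 0 := by
    rintro f hf rfl
    have := hf Set.univ isOpen_univ Set.univ_nonempty 1
    simp at this
    exact continuum_ne_zero this.symm
  have hxE : ∀ X, _ := fun X => hE 1 (MvPolynomial.X 0) (MvPolynomial.X_ne_zero 0)
    (by simp) (fun _ => X) (Function.injective_of_subsingleton _)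
  simp only [MvPolynomial.aeval_X] at hxE
  refine ⟨Set ℂ, x, by simp, fun X Y hXY => ?_, hxE, fun n _ P hP h0 ξ hξ =>
    ⟨hne _ (hE n P hP h0 ξ hξ).1, hE n P hP h0 ξ hξ⟩⟩
  by_contra hXYne
  have hξ : Function.Injective ![X, Y] := by
    intro i j
    fin_cases i <;> fin_cases j <;> simp [hXYne, Ne.symm hXYne]
  have hP : (MvPolynomial.X 0 - MvPolynomial.X 1 : MvPolynomial (Fin 2) ℂ) ≠ 0 :=
    sub_ne_zero.2 fun h => zero_ne_one (MvPolynomial.X_injective h)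
  exact hne _ (hE 2 _ hP (by simp) ![X, Y] hξ).1 (by simp [hXY])
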